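/- arXiv:1806.06044 — 9 statements merged into one kernel-verified Lean document; each statement's English description precedes it below -/
import Mathlib

section
/- Let d ≥ 1 and let r, s : Fin d → ℝ be probability vectors (all entries nonnegative and summing to 1). Then r Fock-majorizes s (i.e. ∑_{i=0}^{m} r_i ≥ ∑_{i=0}^{m} s_i for every m with 0 ≤ m ≤ d−1) if and only if there exists a matrix L : Matrix (Fin d) (Fin d) ℝ which is lower-triangular (L i j = 0 whenever i < j), has nonnegative entries (L i j ≥ 0 for all i ≥ j), is column-stochastic (∑_{i=j}^{d−1} L i j = 1 for every column j), and satisfies s = L.mulVec r (i.e. s_i = ∑_{j=0}^{i} L i j · r_j for every i). -/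
lemma fock_cum (d : ℕ) (r : Fin d → ℝ) (hr0 : ∀ i, 0 ≤ r i) (hr1 : ∑ i, r i = 1) :
    ∃ R : ℕ → ℝ, R 0 = 0 ∧ R d = 1 ∧ Monotone R ∧ (∀ j : Fin d, R (j + 1) = R j + r j) ∧
      (∀ m : Fin d, ∑ i ∈ Finset.Iic m, r i = R (m + 1)) := by
  set r' : ℕ → ℝ := fun n => if h : n < d then r ⟨n, h⟩ else 0 with hr'
  have h1 : ∀ j : Fin d, r' j = r j := fun j => by simp [hr']
  have h0 : ∀ n, 0 ≤ r' n := by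
    intro n
    simp only [hr']
    split_ifs
    · exact hr0 _
    · exact le_rfl
  refine ⟨fun n => ∑ i ∈ Finset.range n, r' i, by simp, ?_, ?_, ?_, ?_⟩
  · simp only
    rw [← Fin.sum_univ_eq_sum_range, ← hr1]
    exact Finset.sum_congr rfl fun j _ => h1 j
  · apply monotone_nat_of_le_succ
    intro n
    rw [Finset.sum_range_succ]
    linarith [h0 n]
  · intro j
    simp only
    rw [Finset.sum_range_succ, h1]
  · intro m
    have : Finset.range ((m : ℕ) + 1) = (Finset.Iic m).map Fin.valEmbedding := by
      rw [Fin.map_valEmbedding_Iic]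
      ext x
      simp
    simp only
    rw [this, Finset.sum_map]
    exact Finset.sum_congr rfl fun j _ => (h1 j).symm

lemma fock_min_super (a a' b b' : ℝ) (ha : a ≤ a') (hb : b ≤ b') :
    0 ≤ (min a' b' - min a b') - (min a' b - min a b) := by
  simp only [min_def]
  split_ifs <;> linarith

lemma fock_tele (d : ℕ) (g : ℕ → ℝ) : ∑ j : Fin d, (g (j + 1) - g j) = g d - g 0 := by
  rw [Fin.sum_univ_eq_sum_range (fun j => g (j + 1) - g j), Finset.sum_range_sub]

lemma fock_plan (d : ℕ) (r s : Fin d → ℝ)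
    (hr0 : ∀ i, 0 ≤ r i) (hr1 : ∑ i, r i = 1)
    (hs0 : ∀ i, 0 ≤ s i) (hs1 : ∑ i, s i = 1)
    (h : ∀ m : Fin d, ∑ i ∈ Finset.Iic m, s i ≤ ∑ i ∈ Finset.Iic m, r i) :
    ∃ P : Fin d → Fin d → ℝ, (∀ i j, 0 ≤ P i j) ∧ (∀ i j, i < j → P i j = 0) ∧
      (∀ j, ∑ i, P i j = r j) ∧ (∀ i, ∑ j, P i j = s i) := by
  obtain ⟨R, R0, R1, Rm, Rs, Rc⟩ := fock_cum d r hr0 hr1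
  obtain ⟨S, S0, S1, Sm, Ss, Sc⟩ := fock_cum d s hs0 hs1
  have hSR : ∀ m : Fin d, S (m + 1) ≤ R (m + 1) := fun m => by
    rw [← Rc, ← Sc]; exact h m
  have key : ∀ i j : Fin d, 0 ≤ (min (S (i+1)) (R (j+1)) - min (S i) (R (j+1)))
      - (min (S (i+1)) (R j) - min (S i) (R j)) := fun i j =>
    fock_min_super _ _ _ _ (Sm (Nat.le_succ _)) (Rm (Nat.le_succ _))
  refine ⟨fun i j => (min (S (i+1)) (R (j+1)) - min (S i) (R (j+1)))
      - (min (S (i+1)) (R j) - min (S i) (R j)), key, ?_, ?_, ?_⟩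
  · intro i j hij
    have hij' : (i : ℕ) + 1 ≤ j := hij
    have a1 := hSR i
    have a2 := Rm hij'
    have a3 := Rm (Nat.le_succ (j : ℕ))
    have a4 := Sm (Nat.le_succ (i : ℕ))
    simp only [Nat.succ_eq_add_one] at a3 a4
    simp only
    rw [min_eq_left (by linarith), min_eq_left (by linarith), min_eq_left (by linarith),
      min_eq_left (by linarith)]
    ring
  · intro j
    simp only
    rw [Finset.sum_sub_distrib, fock_tele d (fun n => min (S n) (R (j+1))),
      fock_tele d (fun n => min (S n) (R j))]
    have b0 := Rm (Nat.zero_le (j : ℕ))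
    have b1 := Rm (Nat.le_succ (j : ℕ))
    have b2 := Rm (Nat.succ_le_of_lt j.2)
    simp only [Nat.succ_eq_add_one] at b1 b2
    simp only [S0, S1]
    rw [min_eq_right (by linarith), min_eq_left (by linarith), min_eq_right (by linarith),
      min_eq_left (by linarith), Rs]
    ring
  · intro i
    have : ∀ j : Fin d, (min (S (i+1)) (R (j+1)) - min (S i) (R (j+1)))
      - (min (S (i+1)) (R j) - min (S i) (R j)) =
      (min (S (i+1)) (R (j+1)) - min (S (i+1)) (R j))
      - (min (S i) (R (j+1)) - min (S i) (R j)) := fun j => by ring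
    simp only [this]
    rw [Finset.sum_sub_distrib, fock_tele d (fun n => min (S (i+1)) (R n)),
      fock_tele d (fun n => min (S i) (R n))]
    have b0 := Sm (Nat.zero_le (i : ℕ))
    have b1 := Sm (Nat.le_succ (i : ℕ))
    have b2 := Sm (Nat.succ_le_of_lt i.2)
    simp only [Nat.succ_eq_add_one] at b1 b2
    simp only [R0, R1]
    rw [min_eq_left (by linarith), min_eq_right (by linarith), min_eq_left (by linarith),
      min_eq_right (by linarith), Ss]
    ring

/-- For probability vectors `r, s` on `Fin d` (`d ≥ 1`), `r` Fock-majorizes `s`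
(prefix sums of `r` dominate those of `s`) iff there exists a lower-triangular,
entrywise-nonnegative, column-stochastic matrix `L` with `s = L.mulVec r`. -/
theorem fock_majorization_iff_lower_triangular_stochastic
    (d : ℕ) (hd : 1 ≤ d) (r s : Fin d → ℝ)
    (hr0 : ∀ i, 0 ≤ r i) (hr1 : ∑ i, r i = 1)
    (hs0 : ∀ i, 0 ≤ s i) (hs1 : ∑ i, s i = 1) :
    (∀ m : Fin d, ∑ i ∈ Finset.Iic m, s i ≤ ∑ i ∈ Finset.Iic m, r i) ↔
      ∃ L : Matrix (Fin d) (Fin d) ℝ,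
        (∀ i j : Fin d, i < j → L i j = 0) ∧
        (∀ i j : Fin d, j ≤ i → 0 ≤ L i j) ∧
        (∀ j : Fin d, ∑ i ∈ Finset.Ici j, L i j = 1) ∧
        s = L.mulVec r := by
  constructor
  · intro h
    obtain ⟨P, P0, Pt, Pc, Pr⟩ := fock_plan d r s hr0 hr1 hs0 hs1 h
    refine ⟨fun i j => if r j = 0 then (if i = j then 1 else 0) else P i j / r j, ?_, ?_, ?_, ?_⟩
    · intro i j hij
      simp [Pt i j hij, hij.ne]
    · intro i j _
      simp only
      split_ifs
      · exact zero_le_one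
      · exact le_rfl
      · exact div_nonneg (P0 i j) (hr0 j)
    · intro j
      rw [Finset.sum_subset (Finset.subset_univ (Finset.Ici j))]
      · by_cases hj : r j = 0
        · simp [hj]
        · simp only [hj, if_false]
          rw [← Finset.sum_div, Pc, div_self hj]
      · intro i _ hi
        have hij : i < j := by simpa using hi
        simp [Pt i j hij, hij.ne]
    · funext i
      rw [← Pr i]
      simp only [Matrix.mulVec, dotProduct]
      refine Finset.sum_congr rfl fun j _ => ?_
      by_cases hj : r j = 0
      · have h2 := Pc j
        rw [hj, Finset.sum_eq_zero_iff_of_nonneg (fun i _ => P0 i j)] at h2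
        simp [hj, h2 i (Finset.mem_univ i)]
      · simp [hj]
  · rintro ⟨L, Lt, L0, Lc, rfl⟩ m
    have L0' : ∀ i j, 0 ≤ L i j := fun i j => by
      rcases lt_or_ge i j with hij | hij
      · rw [Lt i j hij]
      · exact L0 i j hij
    simp only [Matrix.mulVec, dotProduct]
    rw [Finset.sum_comm]
    simp only [← Finset.sum_mul]
    rw [← Finset.sum_subset (Finset.subset_univ (Finset.Iic m))]
    · refine Finset.sum_le_sum fun j _ => ?_
      refine mul_le_of_le_one_left (hr0 j) ?_
      rw [← Lc j, Finset.sum_subset (Finset.subset_univ (Finset.Ici j))]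
      · exact Finset.sum_le_sum_of_subset_of_nonneg (Finset.subset_univ _) fun i _ _ => L0' i j
      · intro i _ hi
        exact Lt i j (by simpa using hi)
    · intro j _ hj
      have hmj : m < j := by simpa using hj
      rw [Finset.sum_eq_zero, zero_mul]
      intro i hi
      exact Lt i j (lt_of_le_of_lt (by simpa using hi) hmj)
end

section
/- Fix η ∈ ℝ with 0 ≤ η ≤ 1 and let B be a beam-splitter coefficient family for η. Then for all i, k ∈ ℕ, ∑_{m=0}^{i+k} B^{(i,k)}_m = 1. -/
/-- Extension of a coefficient family to integer indices: terms with a negative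
index are set to zero (they are "omitted" in the recurrence). -/
noncomputable def bsExt (B : ℕ → ℕ → ℕ → ℝ) : ℤ → ℤ → ℤ → ℝ :=
  fun i k m => if 0 ≤ i ∧ 0 ≤ k ∧ 0 ≤ m then B i.toNat k.toNat m.toNat else 0

/-- A beam-splitter coefficient family for transmittance `η`:
`B^{(i,k)}_m` are the Fock-basis transition probabilities of a beam splitter,
determined by the initial condition `B^{(0,0)}_0 = 1`, the vanishing condition
`B^{(i,k)}_m = 0` for `m > i + k`, and the recurrence relation (terms with a
negative index being omitted). -/
structure IsBSFamily (η : ℝ) (B : ℕ → ℕ → ℕ → ℝ) : Prop where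
  init : B 0 0 0 = 1
  vanish : ∀ i k m : ℕ, i + k < m → B i k m = 0
  recur : ∀ i k m : ℕ, m ≤ i + k → ¬(i = 0 ∧ k = 0 ∧ m = 0) →
    B i k m =
      η * bsExt B ((i : ℤ) - 1) (k : ℤ) ((m : ℤ) - 1)
        + (1 - η) * bsExt B ((i : ℤ) - 1) (k : ℤ) (m : ℤ)
        + η * bsExt B (i : ℤ) ((k : ℤ) - 1) (m : ℤ)
        + (1 - η) * bsExt B (i : ℤ) ((k : ℤ) - 1) ((m : ℤ) - 1)
        - bsExt B ((i : ℤ) - 1) ((k : ℤ) - 1) ((m : ℤ) - 1)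

theorem bsExt_nat (B : ℕ → ℕ → ℕ → ℝ) (a b c : ℕ) : bsExt B a b c = B a b c := by
  simp [bsExt]

theorem bsExt_neg (B : ℕ → ℕ → ℕ → ℝ) (a b c : ℤ) (h : a < 0 ∨ b < 0 ∨ c < 0) :
    bsExt B a b c = 0 := by
  unfold bsExt
  rw [if_neg]
  omega

theorem bsExt_sum_shift (B : ℕ → ℕ → ℕ → ℝ) (a b : ℤ) (N : ℕ) :
    ∑ m ∈ Finset.range (N + 1), bsExt B a b ((m : ℤ) - 1)
      = ∑ m ∈ Finset.range N, bsExt B a b (m : ℤ) := by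
  rw [Finset.sum_range_succ', bsExt_neg B a b _ (by simp)]
  simp

theorem bsFamily_sum_extend {η : ℝ} {B : ℕ → ℕ → ℕ → ℝ} (hB : IsBSFamily η B)
    (i k N : ℕ) (hN : i + k + 1 ≤ N) :
    ∑ m ∈ Finset.range N, B i k m = ∑ m ∈ Finset.range (i + k + 1), B i k m := by
  symm
  apply Finset.sum_subset
  · intro x; simp only [Finset.mem_range]; omega
  · intro x _ hx
    simp only [Finset.mem_range] at hx
    exact hB.vanish i k x (by omega)

theorem bsFamily_sum_rec {η : ℝ} {B : ℕ → ℕ → ℕ → ℝ} (hB : IsBSFamily η B)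
    (i k N : ℕ) (hN : i + k = N) (h : ¬ (i = 0 ∧ k = 0)) :
    ∑ m ∈ Finset.range (N + 1), B i k m =
      η * ∑ m ∈ Finset.range N, bsExt B ((i : ℤ) - 1) k m
      + (1 - η) * ∑ m ∈ Finset.range (N + 1), bsExt B ((i : ℤ) - 1) k m
      + η * ∑ m ∈ Finset.range (N + 1), bsExt B i ((k : ℤ) - 1) m
      + (1 - η) * ∑ m ∈ Finset.range N, bsExt B i ((k : ℤ) - 1) m
      - ∑ m ∈ Finset.range N, bsExt B ((i : ℤ) - 1) ((k : ℤ) - 1) m := by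
  rw [← bsExt_sum_shift B ((i : ℤ) - 1) k N, ← bsExt_sum_shift B i ((k : ℤ) - 1) N,
    ← bsExt_sum_shift B ((i : ℤ) - 1) ((k : ℤ) - 1) N]
  simp only [Finset.mul_sum, ← Finset.sum_add_distrib, ← Finset.sum_sub_distrib]
  apply Finset.sum_congr rfl
  intro m hm
  simp only [Finset.mem_range] at hm
  exact hB.recur i k m (by omega) (by tauto)

/-- For a beam-splitter coefficient family `B` for `η ∈ [0,1]`,
`∑_{m=0}^{i+k} B^{(i,k)}_m = 1` for all `i, k`. -/
theorem bsFamily_sum_eq_one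
    (η : ℝ) (hη0 : 0 ≤ η) (hη1 : η ≤ 1)
    (B : ℕ → ℕ → ℕ → ℝ) (hB : IsBSFamily η B) :
    ∀ i k : ℕ, ∑ m ∈ Finset.range (i + k + 1), B i k m = 1 := by
  have key : ∀ n i k : ℕ, i + k = n → ∑ m ∈ Finset.range (i + k + 1), B i k m = 1 := by
    intro n
    induction n using Nat.strong_induction_on with
    | _ n ih =>
    intro i k hn
    have E : ∀ a b N : ℕ, a + b < n → a + b + 1 ≤ N →
        ∑ m ∈ Finset.range N, bsExt B (a : ℤ) (b : ℤ) (m : ℤ) = 1 := by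
      intro a b N hab hN
      simp only [bsExt_nat]
      rw [bsFamily_sum_extend hB a b N hN]
      exact ih _ hab a b rfl
    have Z : ∀ (a b : ℤ) (N : ℕ), (a < 0 ∨ b < 0) →
        ∑ m ∈ Finset.range N, bsExt B a b (m : ℤ) = 0 := by
      intro a b N hab
      exact Finset.sum_eq_zero fun m _ => bsExt_neg B a b m (by tauto)
    by_cases h : i = 0 ∧ k = 0
    · obtain ⟨rfl, rfl⟩ := h
      simp [hB.init]
    rw [bsFamily_sum_rec hB i k _ rfl h]
    rcases i with _ | i <;> rcases k with _ | k
    · simp at h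
    · have e : ((k + 1 : ℕ) : ℤ) - 1 = (k : ℤ) := by push_cast; ring
      rw [e, Z (((0 : ℕ) : ℤ) - 1) (k + 1 : ℕ) _ (by simp),
        Z (((0 : ℕ) : ℤ) - 1) (k + 1 : ℕ) _ (by simp), Z (((0 : ℕ) : ℤ) - 1) k _ (by simp),
        E 0 k _ (by omega) (by omega), E 0 k _ (by omega) (by omega)]
      ring
    · have e : ((i + 1 : ℕ) : ℤ) - 1 = (i : ℤ) := by push_cast; ring
      rw [e, Z (i + 1 : ℕ) (((0 : ℕ) : ℤ) - 1) _ (by simp),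
        Z (i + 1 : ℕ) (((0 : ℕ) : ℤ) - 1) _ (by simp), Z i (((0 : ℕ) : ℤ) - 1) _ (by simp),
        E i 0 _ (by omega) (by omega), E i 0 _ (by omega) (by omega)]
      ring
    · have e : ((i + 1 : ℕ) : ℤ) - 1 = (i : ℤ) := by push_cast; ring
      have e' : ((k + 1 : ℕ) : ℤ) - 1 = (k : ℤ) := by push_cast; ring
      rw [e, e', E i (k + 1) _ (by omega) (by omega), E i (k + 1) _ (by omega) (by omega),
        E (i + 1) k _ (by omega) (by omega), E (i + 1) k _ (by omega) (by omega),
        E i k _ (by omega) (by omega)]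
      ring
  exact fun i k => key _ i k rfl
end

section
/- Let η ∈ ℝ with 0 ≤ η ≤ 1, and define the binomial probability b(i, m) := (i choose m) · η^m · (1−η)^{i−m} if m ≤ i, and b(i, m) := 0 if m > i. Then for all I, n ∈ ℕ, ∑_{i=0}^{I} b(i, n) ≥ ∑_{i=0}^{I} b(i, n+1). (This is the pure-loss base case Γ_n^{(I,0)} ≥ 0: the output of a pure-loss channel applied to an unnormalized projector onto the first I+1 Fock states is passive.) -/
/-- The binomial probability `b(i, m) = C(i,m) η^m (1-η)^(i-m)` for `m ≤ i`, `0` otherwise. -/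
noncomputable def binomProb (η : ℝ) (i m : ℕ) : ℝ :=
  if m ≤ i then (i.choose m : ℝ) * η ^ m * (1 - η) ^ (i - m) else 0

theorem binomProb_nonneg_aux (η : ℝ) (hη0 : 0 ≤ η) (hη1 : η ≤ 1) (i m : ℕ) :
    0 ≤ binomProb η i m := by
  unfold binomProb
  have : 0 ≤ 1 - η := by linarith
  split_ifs <;> positivity

theorem binomProb_succ_aux (η : ℝ) (i m : ℕ) :
    binomProb η (i + 1) (m + 1) = η * binomProb η i m + (1 - η) * binomProb η i (m + 1) := by
  unfold binomProb
  rcases lt_trichotomy i m with h | h | h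
  · rw [if_neg (by omega), if_neg (by omega), if_neg (by omega)]; ring
  · subst h
    simp [pow_succ, mul_comm]
  · rw [if_pos (by omega), if_pos (by omega), if_pos (by omega)]
    obtain ⟨k, rfl⟩ : ∃ k, i = m + 1 + k := ⟨i - (m + 1), by omega⟩
    rw [Nat.choose_succ_succ, show m + 1 + k + 1 - (m + 1) = k + 1 by omega,
      show m + 1 + k - m = k + 1 by omega, show m + 1 + k - (m + 1) = k by omega]
    push_cast
    ring

theorem binomProb_sum_aux (η : ℝ) (n I : ℕ) :
    η * (∑ i ∈ Finset.range (I + 1), binomProb η i n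
      - ∑ i ∈ Finset.range (I + 1), binomProb η i (n + 1)) = binomProb η (I + 1) (n + 1) := by
  induction I with
  | zero =>
    have h0 : binomProb η 0 (n + 1) = 0 := by simp [binomProb]
    rw [binomProb_succ_aux]
    simp [h0]
  | succ I ih =>
    rw [Finset.sum_range_succ, Finset.sum_range_succ _ (I + 1), binomProb_succ_aux η (I + 1) n]
    linear_combination ih

/-- `∑_{i=0}^{I} b(i, n) ≥ ∑_{i=0}^{I} b(i, n+1)` (the pure-loss base case
`Γ_n^{(I,0)} ≥ 0`: the output of a pure-loss channel on the unnormalized projector onto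
the first `I+1` Fock states is passive). -/
theorem binomial_sum_passive
    (η : ℝ) (hη0 : 0 ≤ η) (hη1 : η ≤ 1) :
    ∀ I n : ℕ,
      ∑ i ∈ Finset.range (I + 1), binomProb η i (n + 1) ≤
        ∑ i ∈ Finset.range (I + 1), binomProb η i n := by
  intro I n
  rcases hη0.eq_or_lt with h | h
  · apply Finset.sum_le_sum
    intro i _
    have h0 : binomProb η i (n + 1) = 0 := by simp [binomProb, ← h]
    rw [h0]
    exact binomProb_nonneg_aux η hη0 hη1 i n
  · have h1 := binomProb_sum_aux η n I
    have h2 := binomProb_nonneg_aux η hη0 hη1 (I + 1) (n + 1)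
    rw [← h1] at h2
    exact sub_nonneg.mp (nonneg_of_mul_nonneg_right h2 h)
end

section
/- Fix η ∈ ℝ with 0 ≤ η ≤ 1 and let B be a beam-splitter coefficient family for η. For i, K, n ∈ ℕ define Δ_n^{(i,K)} := ∑_{k=0}^{K} ∑_{m=0}^{n} (B^{(i,k)}_m − B^{(i+1,k)}_m), with the convention Δ_{−1}^{(i,K)} := 0. Then for all i, n ∈ ℕ and all K ≥ 1, Δ_n^{(i,K)} = η · B^{(i,K)}_n + η · Δ_n^{(i,K−1)} + (1−η) · Δ_{n−1}^{(i,K−1)}. -/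
/-- `Δ_n^{(i,K)} = ∑_{k=0}^{K} ∑_{m=0}^{n} (B^{(i,k)}_m − B^{(i+1,k)}_m)`,
extended by the convention `Δ_{-1}^{(i,K)} = 0` (argument `n : ℤ`). -/
noncomputable def bsDelta (B : ℕ → ℕ → ℕ → ℝ) (i K : ℕ) (n : ℤ) : ℝ :=
  if 0 ≤ n then
    ∑ k ∈ Finset.range (K + 1), ∑ m ∈ Finset.range (n.toNat + 1), (B i k m - B (i + 1) k m)
  else 0

theorem bs_rec_ss {η : ℝ} {B : ℕ → ℕ → ℕ → ℝ} (hB : IsBSFamily η B) (i k m : ℕ) :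
    B (i+1) (k+1) (m+1) = η * B i (k+1) m + (1-η) * B i (k+1) (m+1)
      + η * B (i+1) k (m+1) + (1-η) * B (i+1) k m - B i k m := by
  by_cases h : m + 1 ≤ i + 1 + (k + 1)
  · have := hB.recur (i+1) (k+1) (m+1) h (by omega)
    have e1 : (0:ℤ) ≤ (i:ℤ)+1 := by omega
    have e2 : (0:ℤ) ≤ (k:ℤ)+1 := by omega
    have e3 : (0:ℤ) ≤ (m:ℤ)+1 := by omega
    simpa [bsExt, e1, e2, e3] using this
  · rw [hB.vanish (i+1) (k+1) (m+1) (by omega), hB.vanish i (k+1) m (by omega),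
      hB.vanish i (k+1) (m+1) (by omega), hB.vanish (i+1) k (m+1) (by omega),
      hB.vanish (i+1) k m (by omega), hB.vanish i k m (by omega)]
    ring

theorem bs_rec_sz {η : ℝ} {B : ℕ → ℕ → ℕ → ℝ} (hB : IsBSFamily η B) (i k : ℕ) :
    B (i+1) (k+1) 0 = (1-η) * B i (k+1) 0 + η * B (i+1) k 0 := by
  have := hB.recur (i+1) (k+1) 0 (by omega) (by omega)
  have e1 : (0:ℤ) ≤ (i:ℤ)+1 := by omega
  have e2 : (0:ℤ) ≤ (k:ℤ)+1 := by omega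
  simpa [bsExt, e1, e2] using this

theorem bs_rec_zs {η : ℝ} {B : ℕ → ℕ → ℕ → ℝ} (hB : IsBSFamily η B) (i m : ℕ) :
    B (i+1) 0 (m+1) = η * B i 0 m + (1-η) * B i 0 (m+1) := by
  by_cases h : m + 1 ≤ i + 1 + 0
  · have := hB.recur (i+1) 0 (m+1) h (by omega)
    have e1 : (0:ℤ) ≤ (i:ℤ)+1 := by omega
    have e3 : (0:ℤ) ≤ (m:ℤ)+1 := by omega
    simpa [bsExt, e1, e3] using this
  · rw [hB.vanish (i+1) 0 (m+1) (by omega), hB.vanish i 0 m (by omega),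
      hB.vanish i 0 (m+1) (by omega)]
    ring

theorem bs_rec_zz {η : ℝ} {B : ℕ → ℕ → ℕ → ℝ} (hB : IsBSFamily η B) (i : ℕ) :
    B (i+1) 0 0 = (1-η) * B i 0 0 := by
  have := hB.recur (i+1) 0 0 (by omega) (by omega)
  have e1 : (0:ℤ) ≤ (i:ℤ)+1 := by omega
  simpa [bsExt, e1] using this

theorem bs_T_zero {η : ℝ} {B : ℕ → ℕ → ℕ → ℝ} (hB : IsBSFamily η B) (i n : ℕ) :
    ∑ m ∈ Finset.range (n+1), (B i 0 m - B (i+1) 0 m) = η * B i 0 n := by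
  induction n with
  | zero => simp only [zero_add, Finset.sum_range_one, bs_rec_zz hB]; ring
  | succ n ih => rw [Finset.sum_range_succ, ih, bs_rec_zs hB]; ring

theorem bs_T_succ {η : ℝ} {B : ℕ → ℕ → ℕ → ℝ} (hB : IsBSFamily η B) (i k n : ℕ) :
    ∑ m ∈ Finset.range (n+1), (B i (k+1) m - B (i+1) (k+1) m) =
      η * (B i (k+1) n - B i k n)
      + η * ∑ m ∈ Finset.range (n+1), (B i k m - B (i+1) k m)
      + (1-η) * ∑ m ∈ Finset.range n, (B i k m - B (i+1) k m) := by
  induction n with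
  | zero =>
    simp only [zero_add, Finset.sum_range_one, Finset.sum_range_zero, bs_rec_sz hB]; ring
  | succ n ih =>
    rw [Finset.sum_range_succ, ih, bs_rec_ss hB,
      Finset.sum_range_succ _ (n+1), Finset.sum_range_succ _ n]
    ring

theorem bs_main {η : ℝ} {B : ℕ → ℕ → ℕ → ℝ} (hB : IsBSFamily η B) (i n K : ℕ) :
    ∑ k ∈ Finset.range (K+1), ∑ m ∈ Finset.range (n+1), (B i k m - B (i+1) k m) =
      η * B i K n
      + η * ∑ k ∈ Finset.range K, ∑ m ∈ Finset.range (n+1), (B i k m - B (i+1) k m)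
      + (1-η) * ∑ k ∈ Finset.range K, ∑ m ∈ Finset.range n, (B i k m - B (i+1) k m) := by
  induction K with
  | zero => simp only [zero_add, Finset.sum_range_one, Finset.sum_range_zero, bs_T_zero hB]; ring
  | succ K ih =>
    have h1 := Finset.sum_range_succ
      (fun k => ∑ m ∈ Finset.range (n+1), (B i k m - B (i+1) k m)) K
    have h2 := Finset.sum_range_succ
      (fun k => ∑ m ∈ Finset.range n, (B i k m - B (i+1) k m)) K
    rw [Finset.sum_range_succ, bs_T_succ hB]
    linear_combination ih - η * h1 - (1-η) * h2

theorem bsDelta_nat (B : ℕ → ℕ → ℕ → ℝ) (i K n : ℕ) : bsDelta B i K (n : ℤ) =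
    ∑ k ∈ Finset.range (K+1), ∑ m ∈ Finset.range (n+1), (B i k m - B (i+1) k m) := by
  simp [bsDelta]

theorem bsDelta_pred (B : ℕ → ℕ → ℕ → ℝ) (i K n : ℕ) : bsDelta B i K ((n : ℤ) - 1) =
    ∑ k ∈ Finset.range (K+1), ∑ m ∈ Finset.range n, (B i k m - B (i+1) k m) := by
  cases n with
  | zero => simp [bsDelta]
  | succ n =>
    have : ((n+1 : ℕ) : ℤ) - 1 = (n : ℤ) := by push_cast; ring
    rw [this, bsDelta_nat]

/-- For a beam-splitter coefficient family `B` for `η ∈ [0,1]`, for all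
`i, n ∈ ℕ` and `K ≥ 1`:
`Δ_n^{(i,K)} = η B^{(i,K)}_n + η Δ_n^{(i,K−1)} + (1−η) Δ_{n−1}^{(i,K−1)}`. -/
theorem bsDelta_recurrence
    (η : ℝ) (hη0 : 0 ≤ η) (hη1 : η ≤ 1)
    (B : ℕ → ℕ → ℕ → ℝ) (hB : IsBSFamily η B) :
    ∀ i n K : ℕ, 1 ≤ K →
      bsDelta B i K (n : ℤ) =
        η * B i K n + η * bsDelta B i (K - 1) (n : ℤ)
          + (1 - η) * bsDelta B i (K - 1) ((n : ℤ) - 1) := by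
  intro i n K hK
  obtain ⟨K, rfl⟩ : ∃ L, K = L + 1 := ⟨K - 1, by omega⟩
  rw [Nat.add_sub_cancel, bsDelta_nat, bsDelta_nat, bsDelta_pred]
  exact bs_main hB i n (K+1)
end

section
/- Fix η ∈ ℝ with 0 ≤ η ≤ 1 and let B be a nonnegative beam-splitter coefficient family for η. Then for all i, K, n ∈ ℕ, Δ_n^{(i,K)} := ∑_{k=0}^{K} ∑_{m=0}^{n} (B^{(i,k)}_m − B^{(i+1,k)}_m) ≥ 0. (This is the ladder of Fock-majorization relations B^↓_η[|i⟩⟨i|] ≻_F B^↓_η[|i+1⟩⟨i+1|] for the passive-environment bosonic channel whose environment is the unnormalized projector onto the first K+1 Fock states.) -/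
theorem bs_rec_full {η : ℝ} {B : ℕ → ℕ → ℕ → ℝ} (hB : IsBSFamily η B) (i k m : ℕ) :
    B (i+1) k m =
      η * bsExt B (i : ℤ) (k : ℤ) ((m : ℤ) - 1)
        + (1 - η) * B i k m
        + η * bsExt B ((i : ℤ) + 1) ((k : ℤ) - 1) (m : ℤ)
        + (1 - η) * bsExt B ((i : ℤ) + 1) ((k : ℤ) - 1) ((m : ℤ) - 1)
        - bsExt B (i : ℤ) ((k : ℤ) - 1) ((m : ℤ) - 1) := by
  by_cases h : m ≤ i + 1 + k
  · have := hB.recur (i+1) k m h (by simp)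
    rw [this]
    have e : bsExt B (i : ℤ) (k : ℤ) (m : ℤ) = B i k m := by simp [bsExt]
    push_cast
    rw [add_sub_cancel_right, e]
  · have v : ∀ a b c : ℤ, a + b < c → bsExt B a b c = 0 := by
      intro a b c hh
      unfold bsExt
      split_ifs with h1
      · exact hB.vanish _ _ _ (by omega)
      · rfl
    rw [hB.vanish (i+1) k m (by omega), hB.vanish i k m (by omega), v _ _ _ (by omega),
      v _ _ _ (by omega), v _ _ _ (by omega), v _ _ _ (by omega)]
    ring

theorem bsExt_nat_s8 (B : ℕ → ℕ → ℕ → ℝ) (i k m : ℕ) : bsExt B i k m = B i k m := by simp [bsExt]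

theorem bs_row0 {η : ℝ} {B : ℕ → ℕ → ℕ → ℝ} (hB : IsBSFamily η B) (i n : ℕ) :
    ∑ m ∈ Finset.range (n+1), B (i+1) 0 m =
      η * ∑ m ∈ Finset.range n, B i 0 m + (1 - η) * ∑ m ∈ Finset.range (n+1), B i 0 m := by
  induction n with
  | zero =>
    have := bs_rec_full hB i 0 0
    simp [bsExt] at this
    simp [this]
  | succ n ih =>
    have := bs_rec_full hB i 0 (n+1)
    have e := bsExt_nat_s8 B i 0 n
    push_cast at this e
    rw [add_sub_cancel_right, e] at this
    simp [bsExt] at this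
    rw [Finset.sum_range_succ, ih, this, Finset.sum_range_succ _ (n+1), Finset.sum_range_succ _ n]
    ring

theorem bs_row {η : ℝ} {B : ℕ → ℕ → ℕ → ℝ} (hB : IsBSFamily η B) (i k n : ℕ) :
    ∑ m ∈ Finset.range (n+1), B (i+1) (k+1) m =
      η * ∑ m ∈ Finset.range n, B i (k+1) m + (1 - η) * ∑ m ∈ Finset.range (n+1), B i (k+1) m
      + η * ∑ m ∈ Finset.range (n+1), B (i+1) k m + (1 - η) * ∑ m ∈ Finset.range n, B (i+1) k m
      - ∑ m ∈ Finset.range n, B i k m := by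
  induction n with
  | zero =>
    have := bs_rec_full hB i (k+1) 0
    have e := bsExt_nat_s8 B (i+1) k 0
    push_cast at this e
    rw [add_sub_cancel_right, e] at this
    simp [bsExt] at this
    simp [this]
  | succ n ih =>
    have := bs_rec_full hB i (k+1) (n+1)
    have e1 := bsExt_nat_s8 B i (k+1) n
    have e2 := bsExt_nat_s8 B (i+1) k (n+1)
    have e3 := bsExt_nat_s8 B (i+1) k n
    have e4 := bsExt_nat_s8 B i k n
    push_cast at this e1 e2 e3 e4
    rw [add_sub_cancel_right, add_sub_cancel_right, e1, e2, e3, e4] at this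
    rw [Finset.sum_range_succ, ih, this]
    simp only [Finset.sum_range_succ]
    ring

theorem bs_tot {η : ℝ} {B : ℕ → ℕ → ℕ → ℝ} (hB : IsBSFamily η B) (i K n : ℕ) :
    ∑ k ∈ Finset.range (K+1), ∑ m ∈ Finset.range (n+1), B (i+1) k m =
      η * ∑ k ∈ Finset.range (K+1), ∑ m ∈ Finset.range n, B i k m
      + (1 - η) * ∑ k ∈ Finset.range (K+1), ∑ m ∈ Finset.range (n+1), B i k m
      + η * ∑ k ∈ Finset.range K, ∑ m ∈ Finset.range (n+1), B (i+1) k m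
      + (1 - η) * ∑ k ∈ Finset.range K, ∑ m ∈ Finset.range n, B (i+1) k m
      - ∑ k ∈ Finset.range K, ∑ m ∈ Finset.range n, B i k m := by
  induction K with
  | zero =>
    simp only [zero_add, Finset.sum_range_one, Finset.range_zero, Finset.sum_empty]
    rw [bs_row0 hB]; ring
  | succ K ih =>
    have r := bs_row hB i K n
    simp only [Finset.sum_range_succ _ (K+1), Finset.sum_range_succ _ K] at ih ⊢
    linear_combination ih + r

theorem bs_aux {η : ℝ} (hη0 : 0 ≤ η) (hη1 : η ≤ 1)
    {B : ℕ → ℕ → ℕ → ℝ} (hB : IsBSFamily η B) (hBnn : ∀ i k m, 0 ≤ B i k m) (i K n : ℕ) :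
    ∑ k ∈ Finset.range K, ∑ m ∈ Finset.range n, B (i+1) k m
      ≤ ∑ k ∈ Finset.range K, ∑ m ∈ Finset.range n, B i k m := by
  induction K generalizing n with
  | zero => simp
  | succ K ih =>
    cases n with
    | zero => simp
    | succ n =>
      have t := bs_tot hB i K n
      have a := mul_nonneg hη0 (sub_nonneg.2 (ih (n+1)))
      have b := mul_nonneg (sub_nonneg.2 hη1) (sub_nonneg.2 (ih n))
      have c := mul_nonneg hη0 (hBnn i K n)
      have d1 := Finset.sum_range_succ (fun k => ∑ m ∈ Finset.range (n+1), B i k m) K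
      have d2 := Finset.sum_range_succ (fun k => ∑ m ∈ Finset.range n, B i k m) K
      have d3 := Finset.sum_range_succ (fun m => B i K m) n
      rw [t, d1, d2, d3]
      linarith

/-- For a nonnegative beam-splitter coefficient family `B` for `η ∈ [0,1]`,
`Δ_n^{(i,K)} = ∑_{k=0}^{K} ∑_{m=0}^{n} (B^{(i,k)}_m − B^{(i+1,k)}_m) ≥ 0`
(the ladder of Fock-majorization relations for the channels `B^[K]_η`). -/
theorem bsDelta_nonneg
    (η : ℝ) (hη0 : 0 ≤ η) (hη1 : η ≤ 1)
    (B : ℕ → ℕ → ℕ → ℝ) (hB : IsBSFamily η B) (hBnn : ∀ i k m, 0 ≤ B i k m) :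
    ∀ i K n : ℕ,
      0 ≤ ∑ k ∈ Finset.range (K + 1), ∑ m ∈ Finset.range (n + 1),
            (B i k m - B (i + 1) k m) := by
  intro i K n
  have := bs_aux hη0 hη1 hB hBnn i (K+1) (n+1)
  simp only [Finset.sum_sub_distrib]
  linarith
end

section
/- Let d ≥ 2 and let T : Matrix (Fin d) (Fin d) ℝ have nonnegative entries and be column-stochastic (∑_{n=0}^{d−1} T n i = 1 for every column i). Then the following are equivalent: (a) for all probability vectors r, s : Fin d → ℝ, if r Fock-majorizes s then T.mulVec r Fock-majorizes T.mulVec s; (b) for every i with i+1 ≤ d−1, the i-th column of T Fock-majorizes the (i+1)-th column of T, i.e. ∑_{n=0}^{m} T n i ≥ ∑_{n=0}^{m} T n (i+1) for every m. -/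
theorem fock_abel (n : ℕ) (f x : Fin (n+1) → ℝ)
    (hf : ∀ i : Fin n, f i.succ ≤ f i.castSucc)
    (hx : ∀ m : Fin n, 0 ≤ ∑ i ∈ Finset.Iic m.castSucc, x i) :
    f (Fin.last n) * ∑ i, x i ≤ ∑ i, f i * x i := by
  induction n with
  | zero => simp
  | succ n ih =>
    have key : ∀ m : Fin (n+1), ∑ i ∈ Finset.Iic m.castSucc, x i
        = ∑ i ∈ Finset.Iic m, x i.castSucc := by
      intro m
      rw [← Fin.map_castSuccEmb_Iic, Finset.sum_map]
      rfl
    have h := ih (fun i => f i.castSucc) (fun i => x i.castSucc)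
      (fun i => hf i.castSucc) (fun m => by
        have := hx m.castSucc
        rwa [key] at this)
    have h0 := hx (Fin.last n)
    rw [key] at h0
    have hl : Finset.Iic (Fin.last n) = Finset.univ := by
      ext i; simp [Fin.le_last]
    rw [hl] at h0
    have h1 := hf (Fin.last n)
    rw [Fin.succ_last] at h1
    rw [Fin.sum_univ_castSucc, Fin.sum_univ_castSucc (f := fun i => f i * x i)]
    have h2 := mul_le_mul_of_nonneg_right h1 h0
    linarith

theorem fock_mulVec {d : ℕ} (T : Matrix (Fin d) (Fin d) ℝ) (s : Fin d → ℝ) (m : Fin d) :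
    ∑ n ∈ Finset.Iic m, T.mulVec s n = ∑ i, (∑ n ∈ Finset.Iic m, T n i) * s i := by
  simp only [Matrix.mulVec, dotProduct]
  rw [Finset.sum_comm]
  simp only [Finset.sum_mul]

/-- For a column-stochastic matrix `T` with nonnegative entries on `Fin d`
(`d ≥ 2`), `T` preserves Fock-majorization of probability vectors iff its columns obey
the ladder of Fock-majorization relations (column `i` Fock-majorizes column `i+1`). -/
theorem fock_majorization_preserving_iff_ladder
    (d : ℕ) (hd : 2 ≤ d) (T : Matrix (Fin d) (Fin d) ℝ)
    (hTnn : ∀ n i : Fin d, 0 ≤ T n i)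
    (hTcol : ∀ i : Fin d, ∑ n : Fin d, T n i = 1) :
    (∀ r s : Fin d → ℝ,
        (∀ i, 0 ≤ r i) → (∑ i, r i = 1) →
        (∀ i, 0 ≤ s i) → (∑ i, s i = 1) →
        (∀ m : Fin d, ∑ i ∈ Finset.Iic m, s i ≤ ∑ i ∈ Finset.Iic m, r i) →
        (∀ m : Fin d,
          ∑ n ∈ Finset.Iic m, T.mulVec s n ≤ ∑ n ∈ Finset.Iic m, T.mulVec r n)) ↔
      (∀ i : Fin d, ∀ hi : (i : ℕ) + 1 < d, ∀ m : Fin d,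
        ∑ n ∈ Finset.Iic m, T n ⟨(i : ℕ) + 1, hi⟩ ≤ ∑ n ∈ Finset.Iic m, T n i) := by
  constructor
  · intro h i hi m
    have := h (Pi.single i 1) (Pi.single ⟨(i : ℕ) + 1, hi⟩ 1)
      (fun j => by by_cases hj : j = i <;> simp [Pi.single_apply, hj])
      (by simp)
      (fun j => by rw [Pi.single_apply]; split_ifs <;> norm_num)
      (by simp)
      (fun k => by
        simp only [Finset.sum_pi_single', Finset.sum_pi_single, Finset.mem_Iic, Fin.le_def]
        split_ifs <;> first | omega | norm_num) m
    rw [fock_mulVec, fock_mulVec] at this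
    simpa [Pi.single_apply] using this
  · intro h r s hr hr1 hs hs1 hrs m
    obtain ⟨n, rfl⟩ : ∃ n, d = n + 1 := ⟨d - 1, by omega⟩
    rw [fock_mulVec, fock_mulVec]
    have := fock_abel n (fun i => ∑ n ∈ Finset.Iic m, T n i) (fun i => r i - s i)
      (fun i => h i.castSucc (by simp) m)
      (fun k => by
        rw [Finset.sum_sub_distrib]
        have := hrs k.castSucc
        linarith)
    simp only [mul_sub, Finset.sum_sub_distrib, hr1, hs1] at this
    linarith
end

section
/- Let d ≥ 2 and let T : Matrix (Fin d) (Fin d) ℝ have nonnegative entries. Then the following are equivalent: (a) for every vector r : Fin d → ℝ with nonnegative, non-increasing entries (r_{j+1} ≤ r_j for all j with j+1 ≤ d−1), the vector T.mulVec r also has non-increasing entries; (b) for every n with n+1 ≤ d−1 and every I with 0 ≤ I ≤ d−1, ∑_{i=0}^{I} T n i ≥ ∑_{i=0}^{I} T (n+1) i. -/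
theorem abel_aux (d : ℕ) (c r : Fin d → ℝ)
    (hr : ∀ j : Fin d, ∀ hj : (j : ℕ) + 1 < d, r ⟨(j : ℕ) + 1, hj⟩ ≤ r j)
    (hc : ∀ I : Fin d, 0 ≤ ∑ i ∈ Finset.Iic I, c i) (m : ℕ) (hm : m < d) :
    r ⟨m, hm⟩ * ∑ i ∈ Finset.Iic (⟨m, hm⟩ : Fin d), c i
      ≤ ∑ i ∈ Finset.Iic (⟨m, hm⟩ : Fin d), c i * r i := by
  induction m with
  | zero =>
    have h : Finset.Iic (⟨0, hm⟩ : Fin d) = {⟨0, hm⟩} := by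
      ext x
      simp [Fin.le_def, Fin.ext_iff]
    rw [h]
    simp [mul_comm]
  | succ m ih =>
    have hm' : m < d := by omega
    have h : Finset.Iic (⟨m + 1, hm⟩ : Fin d)
        = insert ⟨m + 1, hm⟩ (Finset.Iic (⟨m, hm'⟩ : Fin d)) := by
      ext x
      simp only [Finset.mem_Iic, Finset.mem_insert, Fin.le_def, Fin.ext_iff]
      omega
    have hn : (⟨m + 1, hm⟩ : Fin d) ∉ Finset.Iic (⟨m, hm'⟩ : Fin d) := by
      simp [Fin.le_def]
    rw [h, Finset.sum_insert hn, Finset.sum_insert hn]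
    have h1 := ih hm'
    have h2 := mul_le_mul_of_nonneg_right (hr ⟨m, hm'⟩ hm) (hc ⟨m, hm'⟩)
    simp only at h2
    linarith

/-- For a matrix `T` with nonnegative entries on `Fin d` (`d ≥ 2`),
`T.mulVec` maps every nonnegative non-increasing vector to a non-increasing vector iff
the partial row sums satisfy `∑_{i=0}^{I} T n i ≥ ∑_{i=0}^{I} T (n+1) i` for all `n, I`. -/
theorem passive_preserving_iff_row_ladder
    (d : ℕ) (hd : 2 ≤ d) (T : Matrix (Fin d) (Fin d) ℝ)
    (hTnn : ∀ n i : Fin d, 0 ≤ T n i) :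
    (∀ r : Fin d → ℝ,
        (∀ i, 0 ≤ r i) →
        (∀ j : Fin d, ∀ hj : (j : ℕ) + 1 < d, r ⟨(j : ℕ) + 1, hj⟩ ≤ r j) →
        (∀ n : Fin d, ∀ hn : (n : ℕ) + 1 < d,
          T.mulVec r ⟨(n : ℕ) + 1, hn⟩ ≤ T.mulVec r n)) ↔
      (∀ n : Fin d, ∀ hn : (n : ℕ) + 1 < d, ∀ I : Fin d,
        ∑ i ∈ Finset.Iic I, T ⟨(n : ℕ) + 1, hn⟩ i ≤ ∑ i ∈ Finset.Iic I, T n i) := by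
  constructor
  · intro h n hn I
    have key := h (fun i => if i ≤ I then 1 else 0)
      (fun i => by split_ifs <;> norm_num)
      (fun j hj => by
        by_cases h1 : (⟨(j : ℕ) + 1, hj⟩ : Fin d) ≤ I
        · have h2 : j ≤ I := by
            simp only [Fin.le_def] at h1 ⊢
            omega
          simp [h1, h2]
        · simp only [h1, if_false]
          split_ifs <;> norm_num) n hn
    have e : ∀ k : Fin d, T.mulVec (fun i => if i ≤ I then 1 else 0) k
        = ∑ i ∈ Finset.Iic I, T k i := by
      intro k
      simp only [Matrix.mulVec, dotProduct, mul_ite, mul_one, mul_zero]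
      rw [← Finset.sum_filter]
      congr 1
      ext x
      simp
    rwa [e, e] at key
  · intro h r hr0 hr n hn
    have hm : d - 1 < d := by omega
    have hc : ∀ I : Fin d, 0 ≤ ∑ i ∈ Finset.Iic I, (T n i - T ⟨(n : ℕ) + 1, hn⟩ i) := by
      intro I
      rw [Finset.sum_sub_distrib]
      linarith [h n hn I]
    have key := abel_aux d (fun i => T n i - T ⟨(n : ℕ) + 1, hn⟩ i) r hr hc (d - 1) hm
    have hu : Finset.Iic (⟨d - 1, hm⟩ : Fin d) = Finset.univ := by
      ext x
      simp only [Finset.mem_Iic, Finset.mem_univ, Fin.le_def, iff_true]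
      omega
    have h0 := mul_nonneg (hr0 ⟨d - 1, hm⟩) (hc ⟨d - 1, hm⟩)
    have h3 := h0.trans key
    rw [hu] at h3
    simp only [sub_mul, Finset.sum_sub_distrib] at h3
    simp only [Matrix.mulVec, dotProduct]
    linarith
end

section
/- Fix η ∈ ℝ with 0 ≤ η ≤ 1, let B be a nonnegative beam-splitter coefficient family for η, and let λ : ℕ → ℝ satisfy λ_k ≥ 0 for all k, λ_{k+1} ≤ λ_k for all k, and ∑_{k=0}^{∞} λ_k = 1 (tsum). Define T : ℕ → ℕ → ℝ by T n i := ∑_{k=0}^{∞} λ_k · B^{(i,k)}_n, and for a sequence r : ℕ → ℝ define (T r)_n := ∑_{i=0}^{∞} T n i · r_i. Then for all sequences r, s : ℕ → ℝ with nonnegative entries, ∑_{i=0}^{∞} r_i = 1, ∑_{i=0}^{∞} s_i = 1, and ∑_{i=0}^{n} r_i ≥ ∑_{i=0}^{n} s_i for every n ∈ ℕ, one has ∑_{m=0}^{n} (T r)_m ≥ ∑_{m=0}^{n} (T s)_m for every n ∈ ℕ. (Passive-environment bosonic channels B^↓_η are Fock-majorization preserving on Fock-diagonal states.) -/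
/-- Fock-basis transition kernel `T n i = ∑'_k λ_k B^{(i,k)}_n` of the
passive-environment bosonic channel with environment eigenvalues `λ`. -/
noncomputable def peKernel (B : ℕ → ℕ → ℕ → ℝ) (lam : ℕ → ℝ) (n i : ℕ) : ℝ :=
  ∑' k : ℕ, lam k * B i k n

/-- Output Fock-basis diagonal `(T r)_n = ∑'_i T n i · r_i` of the passive-environment
bosonic channel applied to the Fock-diagonal state with diagonal `r`. -/
noncomputable def peApply (B : ℕ → ℕ → ℕ → ℝ) (lam : ℕ → ℝ) (r : ℕ → ℝ) (n : ℕ) : ℝ :=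
  ∑' i : ℕ, peKernel B lam n i * r i

open Finset in
theorem aux_abel (l d : ℕ → ℝ) (hl0 : ∀ k, 0 ≤ l k) (hl : ∀ k, l (k + 1) ≤ l k)
    (hd : ∀ n, ∑ k ∈ range (n + 1), d k ≤ 0) (hs : Summable fun k => l k * d k) :
    ∑' k, l k * d k ≤ 0 := by
  have key : ∀ n, ∑ k ∈ range (n + 1), l k * d k ≤ l n * ∑ k ∈ range (n + 1), d k := by
    intro n
    induction n with
    | zero => simp
    | succ n ih =>
      rw [sum_range_succ, sum_range_succ d (n + 1)]
      nlinarith [hl n, hd n]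
  have ht := (hs.hasSum.tendsto_sum_nat).comp (Filter.tendsto_add_atTop_nat 1)
  refine le_of_tendsto' ht fun n => ?_
  exact (key n).trans (mul_nonpos_of_nonneg_of_nonpos (hl0 n) (hd n))

section
variable {η : ℝ} {B : ℕ → ℕ → ℕ → ℝ}

/-- Partial sums of the coefficients. -/
noncomputable def bsA (B : ℕ → ℕ → ℕ → ℝ) (i k n : ℕ) : ℝ := ∑ m ∈ Finset.range n, B i k m

theorem bsExt_cast (i k m : ℕ) : bsExt B i k m = B i k m := by
  simp [bsExt]

theorem bsA_succ (i k n : ℕ) : bsA B i k (n + 1) = bsA B i k n + B i k n :=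
  Finset.sum_range_succ _ _

theorem bsA_zero (i k : ℕ) : bsA B i k 0 = 0 := by simp [bsA]

theorem rec_all (hB : IsBSFamily η B) (i k m : ℕ) (h : ¬(i = 0 ∧ k = 0 ∧ m = 0)) : B i k m =
      η * bsExt B ((i : ℤ) - 1) (k : ℤ) ((m : ℤ) - 1)
        + (1 - η) * bsExt B ((i : ℤ) - 1) (k : ℤ) (m : ℤ)
        + η * bsExt B (i : ℤ) ((k : ℤ) - 1) (m : ℤ)
        + (1 - η) * bsExt B (i : ℤ) ((k : ℤ) - 1) ((m : ℤ) - 1)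
        - bsExt B ((i : ℤ) - 1) ((k : ℤ) - 1) ((m : ℤ) - 1) := by
  by_cases hm : m ≤ i + k
  · exact hB.recur i k m hm h
  · have hz : ∀ a b c : ℤ, a + b < c → bsExt B a b c = 0 := by
      intro a b c hc
      unfold bsExt
      split_ifs with h1
      · apply hB.vanish; omega
      · rfl
    rw [hB.vanish i k m (by omega), hz _ _ _ (by omega), hz _ _ _ (by omega), hz _ _ _ (by omega),
      hz _ _ _ (by omega), hz _ _ _ (by omega)]
    ring

theorem ext_neg1 (a b : ℤ) : bsExt B (-1) a b = 0 := by simp [bsExt]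
theorem ext_neg2 (a b : ℤ) : bsExt B a (-1) b = 0 := by simp [bsExt]
theorem ext_neg3 (a b : ℤ) : bsExt B a b (-1) = 0 := by simp [bsExt]

theorem recA (hB : IsBSFamily η B) (i k n : ℕ) : bsA B (i+1) (k+1) (n+1) =
    η * bsA B i (k+1) n + (1 - η) * bsA B i (k+1) (n+1) + η * bsA B (i+1) k (n+1)
      + (1 - η) * bsA B (i+1) k n - bsA B i k n := by
  induction n with
  | zero =>
    have h := rec_all hB (i+1) (k+1) 0 (by omega)
    have e1 : ((i + 1 : ℕ) : ℤ) - 1 = (i : ℕ) := by push_cast; ring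
    have e2 : ((k + 1 : ℕ) : ℤ) - 1 = (k : ℕ) := by push_cast; ring
    have e3 : ((0 : ℕ) : ℤ) - 1 = -1 := by simp
    rw [e1, e2, e3] at h
    simp only [ext_neg3, bsExt_cast] at h
    simp only [bsA_succ, bsA_zero]
    linarith
  | succ n ih =>
    have h := rec_all hB (i+1) (k+1) (n+1) (by omega)
    have e1 : ((i + 1 : ℕ) : ℤ) - 1 = (i : ℕ) := by push_cast; ring
    have e2 : ((k + 1 : ℕ) : ℤ) - 1 = (k : ℕ) := by push_cast; ring
    have e3 : ((n + 1 : ℕ) : ℤ) - 1 = (n : ℕ) := by push_cast; ring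
    rw [e1, e2, e3] at h
    simp only [bsExt_cast] at h
    simp only [bsA_succ] at ih ⊢
    linarith

theorem recA0 (hB : IsBSFamily η B) (i n : ℕ) : bsA B (i+1) 0 (n+1) =
    η * bsA B i 0 n + (1 - η) * bsA B i 0 (n+1) := by
  have e1 : ((i + 1 : ℕ) : ℤ) - 1 = (i : ℕ) := by push_cast; ring
  have e2 : ((0 : ℕ) : ℤ) - 1 = -1 := by simp
  induction n with
  | zero =>
    have h := rec_all hB (i+1) 0 0 (by omega)
    rw [e1, e2] at h
    simp only [ext_neg2, ext_neg3, bsExt_cast] at h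
    simp only [bsA_succ, bsA_zero]
    linarith
  | succ n ih =>
    have h := rec_all hB (i+1) 0 (n+1) (by omega)
    have e3 : ((n + 1 : ℕ) : ℤ) - 1 = (n : ℕ) := by push_cast; ring
    rw [e1, e2, e3] at h
    simp only [ext_neg2, bsExt_cast] at h
    simp only [bsA_succ] at ih ⊢
    linarith

theorem recA0' (hB : IsBSFamily η B) (k n : ℕ) : bsA B 0 (k+1) (n+1) =
    η * bsA B 0 k (n+1) + (1 - η) * bsA B 0 k n := by
  have e1 : ((k + 1 : ℕ) : ℤ) - 1 = (k : ℕ) := by push_cast; ring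
  have e2 : ((0 : ℕ) : ℤ) - 1 = -1 := by simp
  induction n with
  | zero =>
    have h := rec_all hB 0 (k+1) 0 (by omega)
    rw [e1, e2] at h
    simp only [ext_neg1, ext_neg3, bsExt_cast] at h
    simp only [bsA_succ, bsA_zero]
    linarith
  | succ n ih =>
    have h := rec_all hB 0 (k+1) (n+1) (by omega)
    have e3 : ((n + 1 : ℕ) : ℤ) - 1 = (n : ℕ) := by push_cast; ring
    rw [e1, e2, e3] at h
    simp only [ext_neg1, bsExt_cast] at h
    simp only [bsA_succ] at ih ⊢
    linarith

theorem bsA_total (hB : IsBSFamily η B) (i : ℕ) : ∀ k n, i + k ≤ n → bsA B i k (n+1) = 1 := by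
  induction i with
  | zero =>
    intro k
    induction k with
    | zero =>
      intro n _
      induction n with
      | zero => simp [bsA, hB.init]
      | succ n ih => rw [bsA_succ, ih (by omega), hB.vanish _ _ _ (by omega)]; ring
    | succ k ih =>
      intro n hn
      obtain ⟨n, rfl⟩ : ∃ j, n = j + 1 := ⟨n - 1, by omega⟩
      rw [recA0' hB, ih _ (by omega), ih _ (by omega)]; ring
  | succ i ihi =>
    intro k
    induction k with
    | zero =>
      intro n hn
      obtain ⟨n, rfl⟩ : ∃ j, n = j + 1 := ⟨n - 1, by omega⟩
      rw [recA0 hB, ihi _ _ (by omega), ihi _ _ (by omega)]; ring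
    | succ k ih =>
      intro n hn
      obtain ⟨n, rfl⟩ : ∃ j, n = j + 1 := ⟨n - 1, by omega⟩
      rw [recA hB, ih _ (by omega), ih _ (by omega), ihi _ _ (by omega), ihi _ _ (by omega),
        ihi _ _ (by omega)]
      ring

theorem bsA_le_one (hB : IsBSFamily η B) (hBnn : ∀ i k m, 0 ≤ B i k m) (i k n : ℕ) :
    bsA B i k n ≤ 1 := by
  rw [← bsA_total hB i k (max n (i + k)) (le_max_right _ _)]
  apply Finset.sum_le_sum_of_subset_of_nonneg
  · apply Finset.range_mono; omega
  · intros; apply hBnn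

theorem bsA_nonneg (hBnn : ∀ i k m, 0 ≤ B i k m) (i k n : ℕ) : 0 ≤ bsA B i k n :=
  Finset.sum_nonneg fun _ _ => hBnn _ _ _

/-- Double partial sums of differences. -/
noncomputable def bsQ (B : ℕ → ℕ → ℕ → ℝ) (i K n : ℕ) : ℝ :=
  ∑ k ∈ Finset.range (K + 1), (bsA B (i+1) k n - bsA B i k n)

theorem bsQ_succ (i K n : ℕ) :
    bsQ B i (K+1) n = bsQ B i K n + (bsA B (i+1) (K+1) n - bsA B i (K+1) n) :=
  Finset.sum_range_succ _ _

theorem bsQ_zero (i n : ℕ) : bsQ B i 0 n = bsA B (i+1) 0 n - bsA B i 0 n := by simp [bsQ]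

theorem bsQ_rec (hB : IsBSFamily η B) (i K n : ℕ) : bsQ B i (K+1) (n+1) =
    η * bsQ B i K (n+1) + (1 - η) * bsQ B i K n - η * B i (K+1) n := by
  induction K with
  | zero =>
    rw [bsQ_succ, bsQ_zero, bsQ_zero, recA hB, recA0 hB]
    have h := recA0 hB i n
    simp only [bsA_succ] at h ⊢
    linear_combination (0 : ℝ) * h
  | succ K ih =>
    have h1 := bsQ_succ (B := B) i (K+1) (n+1)
    have q1 := bsQ_succ (B := B) i K (n+1)
    have q2 := bsQ_succ (B := B) i K n
    have hr := recA hB i (K+1) n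
    simp only [bsA_succ] at h1 q1 q2 hr
    linear_combination h1 + ih + hr - η * q1 - (1 - η) * q2

theorem bsQ_nonpos (hη0 : 0 ≤ η) (hη1 : η ≤ 1) (hB : IsBSFamily η B)
    (hBnn : ∀ i k m, 0 ≤ B i k m) (i K n : ℕ) : bsQ B i K n ≤ 0 := by
  induction K generalizing n with
  | zero =>
    cases n with
    | zero => simp [bsQ, bsA]
    | succ n =>
      rw [bsQ_zero, recA0 hB, bsA_succ]
      nlinarith [hBnn i 0 n]
  | succ K ih =>
    cases n with
    | zero => simp [bsQ, bsA]
    | succ n =>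
      rw [bsQ_rec hB]
      nlinarith [mul_nonneg hη0 (hBnn i (K+1) n), mul_nonneg hη0 (neg_nonneg.2 (ih (n+1))),
        mul_nonneg (sub_nonneg.2 hη1) (neg_nonneg.2 (ih n))]

theorem B_le_one (hB : IsBSFamily η B) (hBnn : ∀ i k m, 0 ≤ B i k m) (i k n : ℕ) :
    B i k n ≤ 1 := by
  have := bsA_le_one hB hBnn i k (n+1)
  rw [bsA_succ] at this
  linarith [bsA_nonneg hBnn i k n]

end

/-- Passive-environment bosonic channels `B^↓_η` are Fock-majorization
preserving on Fock-diagonal states: if the probability sequence `r` Fock-majorizes `s`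
(prefix-sum dominance), then `T r` Fock-majorizes `T s`. -/
theorem peChannel_fock_majorization_preserving
    (η : ℝ) (hη0 : 0 ≤ η) (hη1 : η ≤ 1)
    (B : ℕ → ℕ → ℕ → ℝ) (hB : IsBSFamily η B) (hBnn : ∀ i k m, 0 ≤ B i k m)
    (lam : ℕ → ℝ) (hlam0 : ∀ k, 0 ≤ lam k) (hlamMono : ∀ k, lam (k + 1) ≤ lam k)
    (hlamSum : ∑' k : ℕ, lam k = 1)
    (r s : ℕ → ℝ)
    (hr0 : ∀ i, 0 ≤ r i) (hr1 : ∑' i : ℕ, r i = 1)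
    (hs0 : ∀ i, 0 ≤ s i) (hs1 : ∑' i : ℕ, s i = 1)
    (hmaj : ∀ n : ℕ, ∑ i ∈ Finset.range (n + 1), s i ≤ ∑ i ∈ Finset.range (n + 1), r i) :
    ∀ n : ℕ,
      ∑ m ∈ Finset.range (n + 1), peApply B lam s m ≤
        ∑ m ∈ Finset.range (n + 1), peApply B lam r m := by
  intro n
  have hlS : Summable lam := by
    by_contra h; rw [tsum_eq_zero_of_not_summable h] at hlamSum; norm_num at hlamSum
  have hrS : Summable r := by
    by_contra h; rw [tsum_eq_zero_of_not_summable h] at hr1; norm_num at hr1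
  have hsS : Summable s := by
    by_contra h; rw [tsum_eq_zero_of_not_summable h] at hs1; norm_num at hs1
  have hsumB : ∀ i m, Summable fun k => lam k * B i k m := fun i m =>
    Summable.of_nonneg_of_le (fun k => mul_nonneg (hlam0 k) (hBnn _ _ _))
      (fun k => mul_le_of_le_one_right (hlam0 k) (B_le_one hB hBnn i k m)) hlS
  have hsumA : ∀ i, Summable fun k => lam k * bsA B i k (n+1) := fun i =>
    Summable.of_nonneg_of_le (fun k => mul_nonneg (hlam0 k) (bsA_nonneg hBnn _ _ _))
      (fun k => mul_le_of_le_one_right (hlam0 k) (bsA_le_one hB hBnn i k _)) hlS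
  have hK0 : ∀ m i, 0 ≤ peKernel B lam m i := fun m i =>
    tsum_nonneg fun k => mul_nonneg (hlam0 k) (hBnn _ _ _)
  have hK1 : ∀ m i, peKernel B lam m i ≤ 1 := fun m i => by
    rw [← hlamSum]
    exact (hsumB i m).tsum_le_tsum
      (fun k => mul_le_of_le_one_right (hlam0 k) (B_le_one hB hBnn i k m)) hlS
  have hKS : ∀ q : ℕ → ℝ, (∀ i, 0 ≤ q i) → Summable q → ∀ m,
      Summable fun i => peKernel B lam m i * q i := fun q hq0 hq m =>
    Summable.of_nonneg_of_le (fun i => mul_nonneg (hK0 _ _) (hq0 i))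
      (fun i => mul_le_of_le_one_left (hq0 i) (hK1 m i)) hq
  set S : ℕ → ℝ := fun i => ∑ m ∈ Finset.range (n+1), peKernel B lam m i with hS
  have hSA : ∀ i, S i = ∑' k, lam k * bsA B i k (n+1) := by
    intro i
    simp only [hS, peKernel, bsA, Finset.mul_sum]
    exact (Summable.tsum_finsetSum fun m _ => hsumB i m).symm
  have hout : ∀ q : ℕ → ℝ, (∀ i, 0 ≤ q i) → Summable q →
      HasSum (fun i => S i * q i) (∑ m ∈ Finset.range (n + 1), peApply B lam q m) := by
    intro q hq0 hq
    simp only [hS, Finset.sum_mul]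
    exact hasSum_sum fun m _ => (hKS q hq0 hq m).hasSum
  have hSmono : ∀ i, S (i+1) ≤ S i := by
    intro i
    have h1 : Summable fun k => lam k * (bsA B (i+1) k (n+1) - bsA B i k (n+1)) := by
      simp only [mul_sub]; exact (hsumA _).sub (hsumA _)
    have h2 := aux_abel lam _ hlam0 hlamMono
      (fun K => bsQ_nonpos hη0 hη1 hB hBnn i K (n+1)) h1
    simp only [mul_sub] at h2
    rw [(hsumA _).tsum_sub (hsumA _), ← hSA, ← hSA] at h2
    linarith
  have hr' := hout r hr0 hrS
  have hs' := hout s hs0 hsS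
  have hd := hs'.sub hr'
  simp only [← mul_sub] at hd
  have h3 := aux_abel S (fun i => s i - r i)
    (fun i => Finset.sum_nonneg fun m _ => hK0 m i) hSmono
    (fun K => by rw [Finset.sum_sub_distrib]; linarith [hmaj K]) hd.summable
  rw [hd.tsum_eq] at h3
  linarith
end

section
/- Fix η ∈ ℝ with 0 ≤ η ≤ 1, let B be a nonnegative beam-splitter coefficient family for η, and let λ : ℕ → ℝ satisfy λ_k ≥ 0 for all k, λ_{k+1} ≤ λ_k for all k, and ∑_{k=0}^{∞} λ_k = 1 (tsum). Define T : ℕ → ℕ → ℝ by T n i := ∑_{k=0}^{∞} λ_k · B^{(i,k)}_n, and for a sequence r : ℕ → ℝ define (T r)_n := ∑_{i=0}^{∞} T n i · r_i. Let r, s : ℕ → ℝ be nonnegative, non-increasing sequences (r_{i+1} ≤ r_i and s_{i+1} ≤ s_i for all i) with ∑_{i=0}^{∞} r_i = 1 and ∑_{i=0}^{∞} s_i = 1, such that ∑_{i=0}^{n} r_i ≥ ∑_{i=0}^{n} s_i for every n (i.e. r majorizes s, these being passive). Then T r and T s are non-increasing and ∑_{m=0}^{n} (T r)_m ≥ ∑_{m=0}^{n}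 (T s)_m for every n; that is, T r majorizes T s. (Passive-environment bosonic channels B^↓_η are majorization-preserving over the set of passive states.) -/
/-- Coefficients with all indices shifted by one, zero on the boundary. -/
def bsC (B : ℕ → ℕ → ℕ → ℝ) : ℕ → ℕ → ℕ → ℝ
  | i + 1, k + 1, m + 1 => B i k m
  | _, _, _ => 0

theorem bsC_succ (B : ℕ → ℕ → ℕ → ℝ) (i k m : ℕ) : bsC B (i+1) (k+1) (m+1) = B i k m := rfl

theorem bsC_0a (B : ℕ → ℕ → ℕ → ℝ) (k m : ℕ) : bsC B 0 k m = 0 := by simp [bsC]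

theorem bsC_0b (B : ℕ → ℕ → ℕ → ℝ) (i m : ℕ) : bsC B i 0 m = 0 := by cases i <;> simp [bsC]

theorem bsC_0c (B : ℕ → ℕ → ℕ → ℝ) (i k : ℕ) : bsC B i k 0 = 0 := by
  cases i <;> cases k <;> simp [bsC]

theorem bsExt_eq (B : ℕ → ℕ → ℕ → ℝ) (i k m : ℕ) :
    bsExt B ((i:ℤ) - 1) ((k:ℤ) - 1) ((m:ℤ) - 1) = bsC B i k m := by
  rcases i with _ | i
  · simp [bsExt, bsC_0a]
  rcases k with _ | k
  · simp [bsExt, bsC_0b]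
  rcases m with _ | m
  · simp [bsExt, bsC_0c]
  simp [bsExt, bsC_succ]

theorem bsC_nonneg (B : ℕ → ℕ → ℕ → ℝ) (hBnn : ∀ i k m, 0 ≤ B i k m) (i k m : ℕ) :
    0 ≤ bsC B i k m := by
  rcases i with _ | i
  · simp [bsC_0a]
  rcases k with _ | k
  · simp [bsC_0b]
  rcases m with _ | m
  · simp [bsC_0c]
  exact hBnn i k m

theorem bsC_vanish {η : ℝ} {B : ℕ → ℕ → ℕ → ℝ} (hB : IsBSFamily η B) (i k m : ℕ)
    (h : i + k ≤ m) : bsC B i k m = 0 := by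
  rcases i with _ | i
  · simp [bsC_0a]
  rcases k with _ | k
  · simp [bsC_0b]
  rcases m with _ | m
  · simp [bsC_0c]
  exact hB.vanish i k m (by omega)

theorem bsC_recur {η : ℝ} {B : ℕ → ℕ → ℕ → ℝ} (hB : IsBSFamily η B) (i k m : ℕ) :
    bsC B (i+1) (k+1) (m+1) = η * bsC B i (k+1) m + (1 - η) * bsC B i (k+1) (m+1)
      + η * bsC B (i+1) k (m+1) + (1 - η) * bsC B (i+1) k m - bsC B i k m
      + (if i = 0 ∧ k = 0 ∧ m = 0 then 1 else 0) := by
  by_cases h0 : i = 0 ∧ k = 0 ∧ m = 0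
  · obtain ⟨rfl, rfl, rfl⟩ := h0
    simp [bsC_0a, bsC_0b, bsC_succ, hB.init]
  rw [if_neg h0]
  by_cases hm : m ≤ i + k
  · have h := hB.recur i k m hm h0
    have e1 : ∀ n : ℕ, (n : ℤ) = ((n + 1 : ℕ) : ℤ) - 1 := by intro n; push_cast; ring
    have h1 := bsExt_eq B i (k+1) m
    have h2 := bsExt_eq B i (k+1) (m+1)
    have h3 := bsExt_eq B (i+1) k (m+1)
    have h4 := bsExt_eq B (i+1) k m
    have h5 := bsExt_eq B i k m
    rw [← e1] at h1 h3 h4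
    rw [← e1, ← e1] at h2
    rw [← e1] at h3
    rw [h1, h2, h3, h4, h5] at h
    rw [bsC_succ, h]; ring
  · rw [bsC_vanish hB (i+1) (k+1) (m+1) (by omega), bsC_vanish hB i (k+1) m (by omega),
      bsC_vanish hB i (k+1) (m+1) (by omega), bsC_vanish hB (i+1) k (m+1) (by omega),
      bsC_vanish hB (i+1) k m (by omega), bsC_vanish hB i k m (by omega)]
    ring

theorem bs_key (u v : ℕ → ℕ → ℝ) (a b c d e f g t : ℝ)
    (ha : 0 ≤ a) (hb : 0 ≤ b) (hf : 0 ≤ f) (ht : 0 ≤ t)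
    (h1 : 1 - g = t) (h2 : a + c = t) (h3 : b + d = t) (h4 : e + f = -t)
    (hu : ∀ i j, 0 ≤ u i j)
    (u0 : ∀ j, u 0 j = 0) (u0' : ∀ i, u i 0 = 0) (v0 : ∀ j, v 0 j = 0) (v0' : ∀ i, v i 0 = 0)
    (h : ∀ i j, v (i+1) (j+1) = a * v i (j+1) + b * v (i+1) j + f * v i j
      + c * u i (j+1) + d * u (i+1) j + e * u i j + g * u (i+1) (j+1)) :
    ∀ I J, ∑ i ∈ Finset.range I, ∑ j ∈ Finset.range J, v (i+1) (j+1)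
      ≤ ∑ i ∈ Finset.range I, ∑ j ∈ Finset.range J, u (i+1) (j+1) := by
  have shift : ∀ w : ℕ → ℕ → ℝ, (∀ j, w 0 j = 0) → (∀ i, w i 0 = 0) → ∀ I J,
      (∑ i ∈ Finset.range (I+1), ∑ j ∈ Finset.range (J+1), w i (j+1)
        = ∑ i ∈ Finset.range I, ∑ j ∈ Finset.range (J+1), w (i+1) (j+1)) ∧
      (∑ i ∈ Finset.range (I+1), ∑ j ∈ Finset.range (J+1), w (i+1) j
        = ∑ i ∈ Finset.range (I+1), ∑ j ∈ Finset.range J, w (i+1) (j+1)) ∧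
      (∑ i ∈ Finset.range (I+1), ∑ j ∈ Finset.range (J+1), w i j
        = ∑ i ∈ Finset.range I, ∑ j ∈ Finset.range J, w (i+1) (j+1)) := by
    intro w w0 w0' I J
    refine ⟨?_, ?_, ?_⟩
    · rw [Finset.sum_range_succ']; simp [w0]
    · refine Finset.sum_congr rfl fun i _ => ?_
      rw [Finset.sum_range_succ']; simp [w0']
    · rw [Finset.sum_range_succ']
      simp only [w0, Finset.sum_const_zero, add_zero]
      refine Finset.sum_congr rfl fun i _ => ?_
      rw [Finset.sum_range_succ']; simp [w0']
  have mixed : ∀ w : ℕ → ℕ → ℝ, ∀ I J,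
      ∑ i ∈ Finset.range (I+1), ∑ j ∈ Finset.range (J+1), w (i+1) (j+1)
        = ∑ i ∈ Finset.range I, ∑ j ∈ Finset.range (J+1), w (i+1) (j+1)
        + ∑ i ∈ Finset.range (I+1), ∑ j ∈ Finset.range J, w (i+1) (j+1)
        - ∑ i ∈ Finset.range I, ∑ j ∈ Finset.range J, w (i+1) (j+1) + w (I+1) (J+1) := by
    intro w I J
    rw [Finset.sum_range_succ _ I, Finset.sum_range_succ _ I, Finset.sum_range_succ _ J]
    ring
  intro I
  induction I with
  | zero => intro J; simp
  | succ I ihI =>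
    intro J
    induction J with
    | zero => simp
    | succ J ihJ =>
      have hs : ∑ i ∈ Finset.range (I+1), ∑ j ∈ Finset.range (J+1), v (i+1) (j+1)
        = ∑ i ∈ Finset.range (I+1), ∑ j ∈ Finset.range (J+1), (a * v i (j+1) + b * v (i+1) j
          + f * v i j + c * u i (j+1) + d * u (i+1) j + e * u i j + g * u (i+1) (j+1)) :=
        Finset.sum_congr rfl fun i _ => Finset.sum_congr rfl fun j _ => h i j
      simp only [Finset.sum_add_distrib, ← Finset.mul_sum] at hs
      obtain ⟨p1, p2, p3⟩ := shift v v0 v0' I J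
      obtain ⟨q1, q2, q3⟩ := shift u u0 u0' I J
      rw [p1, p2, p3, q1, q2, q3] at hs
      have hm := mixed u I J
      have i1 := mul_nonneg ha (sub_nonneg.2 (ihI (J+1)))
      have i2 := mul_nonneg hb (sub_nonneg.2 ihJ)
      have i3 := mul_nonneg hf (sub_nonneg.2 (ihI J))
      have i4 := mul_nonneg ht (hu (I+1) (J+1))
      generalize ∑ i ∈ Finset.range (I+1), ∑ j ∈ Finset.range (J+1), v (i+1) (j+1) = V at *
      generalize ∑ i ∈ Finset.range (I+1), ∑ j ∈ Finset.range (J+1), u (i+1) (j+1) = U at *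
      have hc : c = t - a := by linarith
      have hd : d = t - b := by linarith
      have he : e = -t - f := by linarith
      have hg : g = 1 - t := by linarith
      subst hc hd he hg
      have hm' := congrArg (fun z => t * z) hm
      rw [← sub_nonneg]
      refine le_of_le_of_eq (add_nonneg (add_nonneg (add_nonneg i1 i2) i3) i4) ?_
      linear_combination hs - hm'

theorem bs_mono_m {η : ℝ} (hη0 : 0 ≤ η) (hη1 : η ≤ 1) {B : ℕ → ℕ → ℕ → ℝ}
    (hB : IsBSFamily η B) (hBnn : ∀ i k m, 0 ≤ B i k m) (m I J : ℕ) :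
    ∑ i ∈ Finset.range I, ∑ j ∈ Finset.range J, B i j (m+1)
      ≤ ∑ i ∈ Finset.range I, ∑ j ∈ Finset.range J, B i j m := by
  refine bs_key (fun i j => bsC B i j (m+1)) (fun i j => bsC B i j (m+2))
    (1-η) η η (1-η) (-1) 0 0 1 (by linarith) hη0 le_rfl zero_le_one (by ring) (by ring)
    (by ring) (by ring) (fun i j => bsC_nonneg B hBnn _ _ _) (fun j => bsC_0a _ _ _)
    (fun j => bsC_0b _ _ _) (fun j => bsC_0a _ _ _) (fun j => bsC_0b _ _ _) ?_ I J
  intro i j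
  have := bsC_recur hB i j (m+1)
  simp only [Nat.succ_ne_zero, and_false, if_false] at this
  rw [this]; ring

theorem bs_mono_i {η : ℝ} (hη0 : 0 ≤ η) (hη1 : η ≤ 1) {B : ℕ → ℕ → ℕ → ℝ}
    (hB : IsBSFamily η B) (hBnn : ∀ i k m, 0 ≤ B i k m) (i K M : ℕ) :
    ∑ k ∈ Finset.range K, ∑ m ∈ Finset.range M, B (i+1) k m
      ≤ ∑ k ∈ Finset.range K, ∑ m ∈ Finset.range M, B i k m := by
  refine bs_key (fun k m => bsC B (i+1) k m) (fun k m => bsC B (i+2) k m)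
    η 0 0 η (-1) (1-η) (1-η) η hη0 le_rfl (by linarith) hη0 (by ring) (by ring)
    (by ring) (by ring) (fun i j => bsC_nonneg B hBnn _ _ _) (fun j => bsC_0b _ _ _)
    (fun j => bsC_0c _ _ _) (fun j => bsC_0b _ _ _) (fun j => bsC_0c _ _ _) ?_ K M
  intro k m
  have := bsC_recur hB (i+1) k m
  simp only [Nat.succ_ne_zero, false_and, if_false] at this
  rw [this]; ring

theorem bs_total {η : ℝ} {B : ℕ → ℕ → ℕ → ℝ} (hB : IsBSFamily η B) :
    ∀ i k N : ℕ, i + k + 1 ≤ N →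
      ∑ m ∈ Finset.range (N + 1), bsC B (i+1) (k+1) m = 1 := by
  have step : ∀ i k N : ℕ, 1 ≤ N → ∑ m ∈ Finset.range (N + 1), bsC B (i+1) (k+1) m
      = η * ∑ m ∈ Finset.range N, bsC B i (k+1) m
      + (1 - η) * ∑ m ∈ Finset.range (N+1), bsC B i (k+1) m
      + η * ∑ m ∈ Finset.range (N+1), bsC B (i+1) k m
      + (1 - η) * ∑ m ∈ Finset.range N, bsC B (i+1) k m
      - ∑ m ∈ Finset.range N, bsC B i k m + (if i = 0 ∧ k = 0 then 1 else 0) := by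
    intro i k N hN
    rw [Finset.sum_range_succ', Finset.sum_range_succ', Finset.sum_range_succ']
    simp only [bsC_0c, add_zero, bsC_recur hB i k, Finset.sum_add_distrib,
      Finset.sum_sub_distrib, ← Finset.mul_sum]
    congr 1
    by_cases h : i = 0 ∧ k = 0
    · have h0 : 0 < N := hN
      simp [h.1, h.2, h0]
      try omega
    · rw [if_neg h]
      refine Finset.sum_eq_zero fun m _ => if_neg fun h' => h ⟨h'.1, h'.2.1⟩
  have last : ∀ i k N : ℕ, i + k ≤ N → ∑ m ∈ Finset.range (N+1), bsC B i k m
      = ∑ m ∈ Finset.range N, bsC B i k m := by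
    intro i k N h
    rw [Finset.sum_range_succ, bsC_vanish hB i k N h, add_zero]
  intro i
  induction i with
  | zero =>
    intro k
    induction k with
    | zero =>
      intro N hN
      rw [step 0 0 N (by omega)]
      simp [bsC_0a, bsC_0b]
    | succ k ih =>
      intro N hN
      rw [step 0 (k+1) N (by omega), ← last (0+1) (k+1) N (by omega), ih N (by omega)]
      simp [bsC_0a]
  | succ i ihi =>
    intro k
    induction k with
    | zero =>
      intro N hN
      rw [step (i+1) 0 N (by omega), ← last (i+1) (0+1) N (by omega), ihi 0 N (by omega)]
      simp [bsC_0b]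
    | succ k ih =>
      intro N hN
      rw [step (i+1) (k+1) N (by omega), ← last (i+1) (k+1+1) N (by omega),
        ← last (i+1+1) (k+1) N (by omega), ← last (i+1) (k+1) N (by omega),
        ih N (by omega), ihi k N (by omega), ihi (k+1) N (by omega)]
      simp

theorem bs_le_one {η : ℝ} {B : ℕ → ℕ → ℕ → ℝ} (hB : IsBSFamily η B)
    (hBnn : ∀ i k m, 0 ≤ B i k m) (i k m : ℕ) : B i k m ≤ 1 := by
  rw [← bs_total hB i k (i+k+1+m) (by omega), ← bsC_succ B i k m]
  exact Finset.single_le_sum (f := fun m => bsC B (i+1) (k+1) m)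
    (fun j _ => bsC_nonneg B hBnn _ _ _) (Finset.mem_range.2 (by omega))

theorem abel_fin (x d : ℕ → ℝ) (hxm : ∀ n, x (n+1) ≤ x n)
    (hd : ∀ n, 0 ≤ ∑ i ∈ Finset.range n, d i) (n : ℕ) :
    x n * ∑ i ∈ Finset.range n, d i ≤ ∑ i ∈ Finset.range n, x i * d i := by
  induction n with
  | zero => simp
  | succ n ih =>
    have := mul_le_mul_of_nonneg_right (hxm n) (hd (n+1))
    rw [Finset.sum_range_succ (fun i => x i * d i)]
    rw [Finset.sum_range_succ] at this ⊢
    linarith [mul_add (x n) (∑ i ∈ Finset.range n, d i) (d n)]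

theorem abel_tsum (x d : ℕ → ℝ) (hx0 : ∀ n, 0 ≤ x n) (hxm : ∀ n, x (n+1) ≤ x n)
    (hd : ∀ n, 0 ≤ ∑ i ∈ Finset.range n, d i) (hs : Summable fun i => x i * d i) :
    0 ≤ ∑' i, x i * d i :=
  ge_of_tendsto' hs.hasSum.tendsto_sum_nat fun n =>
    (mul_nonneg (hx0 n) (hd n)).trans (abel_fin x d hxm hd n)

theorem summ_bdd (x b : ℕ → ℝ) (c : ℝ) (hx0 : ∀ n, 0 ≤ x n) (hx : Summable x)
    (hb0 : ∀ n, 0 ≤ b n) (hb1 : ∀ n, b n ≤ c) : Summable fun n => x n * b n :=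
  Summable.of_nonneg_of_le (fun n => mul_nonneg (hx0 n) (hb0 n))
    (fun n => mul_le_mul_of_nonneg_left (hb1 n) (hx0 n)) (hx.mul_right c)

theorem summ_one (x : ℕ → ℝ) (h : ∑' n, x n = 1) : Summable x := by
  by_contra hc
  rw [tsum_eq_zero_of_not_summable hc] at h
  exact zero_ne_one h

/-- Passive-environment bosonic channels `B^↓_η` are majorization-preserving
over the set of passive states: if `r` and `s` are passive (nonnegative, non-increasing)
probability sequences and `r` majorizes `s` (prefix-sum dominance, the entries being
already sorted), then `T r` and `T s` are non-increasing and `T r` majorizes `T s`. -/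
theorem peChannel_majorization_preserving_on_passive
    (η : ℝ) (hη0 : 0 ≤ η) (hη1 : η ≤ 1)
    (B : ℕ → ℕ → ℕ → ℝ) (hB : IsBSFamily η B) (hBnn : ∀ i k m, 0 ≤ B i k m)
    (lam : ℕ → ℝ) (hlam0 : ∀ k, 0 ≤ lam k) (hlamMono : ∀ k, lam (k + 1) ≤ lam k)
    (hlamSum : ∑' k : ℕ, lam k = 1)
    (r s : ℕ → ℝ)
    (hr0 : ∀ i, 0 ≤ r i) (hrMono : ∀ i, r (i + 1) ≤ r i) (hr1 : ∑' i : ℕ, r i = 1)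
    (hs0 : ∀ i, 0 ≤ s i) (hsMono : ∀ i, s (i + 1) ≤ s i) (hs1 : ∑' i : ℕ, s i = 1)
    (hmaj : ∀ n : ℕ, ∑ i ∈ Finset.range (n + 1), s i ≤ ∑ i ∈ Finset.range (n + 1), r i) :
    (∀ n : ℕ, peApply B lam r (n + 1) ≤ peApply B lam r n) ∧
    (∀ n : ℕ, peApply B lam s (n + 1) ≤ peApply B lam s n) ∧
    (∀ n : ℕ,
      ∑ m ∈ Finset.range (n + 1), peApply B lam s m ≤
        ∑ m ∈ Finset.range (n + 1), peApply B lam r m) := by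
  have hL := summ_one lam hlamSum
  have hR := summ_one r hr1
  have hS := summ_one s hs1
  have hB1 := bs_le_one hB hBnn
  have sLB : ∀ i n, Summable fun k => lam k * B i k n := fun i n =>
    summ_bdd lam (fun k => B i k n) 1 hlam0 hL (fun k => hBnn i k n) (fun k => hB1 i k n)
  have hT0 : ∀ n i, 0 ≤ peKernel B lam n i := fun n i =>
    tsum_nonneg fun k => mul_nonneg (hlam0 k) (hBnn i k n)
  have hT1 : ∀ n i, peKernel B lam n i ≤ 1 := by
    intro n i
    rw [← hlamSum]
    exact (sLB i n).tsum_le_tsum (fun k => mul_le_of_le_one_right (hlam0 k) (hB1 i k n)) hL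
  have sT : ∀ (q : ℕ → ℝ), (∀ i, 0 ≤ q i) → Summable q → ∀ n,
      Summable fun i => q i * peKernel B lam n i := fun q hq0 hq n =>
    summ_bdd q _ 1 hq0 hq (hT0 n) (hT1 n)
  have hA : ∀ (q : ℕ → ℝ) n, peApply B lam q n = ∑' i, q i * peKernel B lam n i := by
    intro q n
    exact tsum_congr fun i => mul_comm _ _
  have mono : ∀ (q : ℕ → ℝ), (∀ i, 0 ≤ q i) → (∀ i, q (i+1) ≤ q i) → Summable q →
      ∀ n, peApply B lam q (n+1) ≤ peApply B lam q n := by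
    intro q hq0 hqm hq n
    have hs := (sT q hq0 hq n).sub (sT q hq0 hq (n+1))
    rw [hA, hA, ← sub_nonneg, ← (sT q hq0 hq n).tsum_sub (sT q hq0 hq (n+1))]
    simp only [← mul_sub] at hs ⊢
    refine abel_tsum q _ hq0 hqm ?_ hs
    intro I
    have e : ∀ i, peKernel B lam n i - peKernel B lam (n+1) i
        = ∑' k, (lam k * B i k n - lam k * B i k (n+1)) := fun i =>
      ((sLB i n).tsum_sub (sLB i (n+1))).symm
    have hsum : ∀ i ∈ Finset.range I, Summable fun k =>
        (lam k * B i k n - lam k * B i k (n+1)) := fun i _ => (sLB i n).sub (sLB i (n+1))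
    have hs2 := summable_sum hsum
    simp only [e]
    rw [← Summable.tsum_finsetSum hsum]
    simp only [← mul_sub, ← Finset.mul_sum] at hs2 ⊢
    refine abel_tsum lam _ hlam0 hlamMono ?_ hs2
    intro K
    rw [Finset.sum_comm]
    simp only [Finset.sum_sub_distrib]
    exact sub_nonneg.2 (bs_mono_m hη0 hη1 hB hBnn n I K)
  refine ⟨mono r hr0 hrMono hR, mono s hs0 hsMono hS, ?_⟩
  intro n
  have Fanti : ∀ i, ∑ m ∈ Finset.range (n+1), peKernel B lam m (i+1)
      ≤ ∑ m ∈ Finset.range (n+1), peKernel B lam m i := by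
    intro i
    have hsum : ∀ m ∈ Finset.range (n+1), Summable fun k =>
        (lam k * B i k m - lam k * B (i+1) k m) := fun m _ => (sLB i m).sub (sLB (i+1) m)
    have hs2 := summable_sum hsum
    rw [← sub_nonneg, ← Finset.sum_sub_distrib]
    have e : ∀ m, peKernel B lam m i - peKernel B lam m (i+1)
        = ∑' k, (lam k * B i k m - lam k * B (i+1) k m) := fun m =>
      ((sLB i m).tsum_sub (sLB (i+1) m)).symm
    simp only [e]
    rw [← Summable.tsum_finsetSum hsum]
    simp only [← mul_sub, ← Finset.mul_sum] at hs2 ⊢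
    refine abel_tsum lam _ hlam0 hlamMono ?_ hs2
    intro K
    simp only [Finset.sum_sub_distrib]
    exact sub_nonneg.2 (bs_mono_i hη0 hη1 hB hBnn i K (n+1))
  have hsr : ∀ m ∈ Finset.range (n+1), Summable fun i => r i * peKernel B lam m i :=
    fun m _ => sT r hr0 hR m
  have hss : ∀ m ∈ Finset.range (n+1), Summable fun i => s i * peKernel B lam m i :=
    fun m _ => sT s hs0 hS m
  simp only [hA]
  rw [← Summable.tsum_finsetSum hsr, ← Summable.tsum_finsetSum hss, ← sub_nonneg,
    ← (summable_sum hsr).tsum_sub (summable_sum hss)]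
  have hs3 := (summable_sum hsr).sub (summable_sum hss)
  have e : ∀ i, ∑ m ∈ Finset.range (n+1), r i * peKernel B lam m i
      - ∑ m ∈ Finset.range (n+1), s i * peKernel B lam m i
      = (∑ m ∈ Finset.range (n+1), peKernel B lam m i) * (r i - s i) := by
    intro i
    rw [← Finset.mul_sum, ← Finset.mul_sum]; ring
  simp only [e] at hs3 ⊢
  refine abel_tsum _ _ (fun i => Finset.sum_nonneg fun m _ => hT0 m i) Fanti ?_ hs3
  intro N
  rw [Finset.sum_sub_distrib, sub_nonneg]
  rcases N with _ | N
  · simp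
  · exact hmaj N
end
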